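/- Let Γ be a finite connected simplicial graph and suppose A(Γ) acts without inversions on a simplicial tree T with abelian edge stabilizers, such that every vertex of Γ acts elliptically and there is no global fixed vertex. Then Γ contains a separating clique K all of whose vertices have a common fixed edge in T (i.e., the subgroup generated by the vertices of K stabilizes an edge of T). -/

import Mathlib

/-- The relators of the right-angled Artin group of a graph `Γ`: one commutator
relator for each pair of adjacent vertices. -/
def raagRels {V : Type} (Γ : SimpleGraph V) : Set (FreeGroup V) :=
  {r | ∃ u v : V, Γ.Adj u v ∧
    r = FreeGroup.of u * FreeGroup.of v * (FreeGroup.of u)⁻¹ * (FreeGroup.of v)⁻¹}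

/-- The right-angled Artin group `A(Γ)` of a graph `Γ`. -/
abbrev RAAG {V : Type} (Γ : SimpleGraph V) : Type := PresentedGroup (raagRels Γ)

/-- The generator of `RAAG Γ` corresponding to a vertex `v`. -/
def RAAG.gen {V : Type} (Γ : SimpleGraph V) (v : V) : RAAG Γ := PresentedGroup.of v

section Action

variable {G W : Type} [Group G]

/-- The homomorphism `φ : G →* Equiv.Perm W` acts by automorphisms of the graph `T`. -/
def PreservesAdj (T : SimpleGraph W) (φ : G →* Equiv.Perm W) : Prop :=
  ∀ (g : G) (u v : W), T.Adj u v → T.Adj (φ g u) (φ g v)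

/-- The action `φ` on the graph `T` is without edge inversions. -/
def NoInversions (T : SimpleGraph W) (φ : G →* Equiv.Perm W) : Prop :=
  ∀ (g : G) (u v : W), T.Adj u v → ¬(φ g u = v ∧ φ g v = u)

/-- All edge stabilizers of the action `φ` on the graph `T` are abelian: any two
elements fixing both endpoints of an edge commute. -/
def AbelianEdgeStabilizers (T : SimpleGraph W) (φ : G →* Equiv.Perm W) : Prop :=
  ∀ u v : W, T.Adj u v → ∀ g h : G,
    φ g u = u → φ g v = v → φ h u = u → φ h v = v → g * h = h * g

/-- An element `g` is elliptic for the action `φ` if it fixes some vertex. -/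
def Elliptic (φ : G →* Equiv.Perm W) (g : G) : Prop := ∃ w : W, φ g w = w

/-- The action `φ` has a global fixed vertex. -/
def HasGlobalFixedVertex (φ : G →* Equiv.Perm W) : Prop := ∃ w : W, ∀ g : G, φ g w = w

end Action

/-- `K` is a separating clique of `Γ`: a clique whose removal disconnects `Γ`. -/
def SeparatingClique {V : Type} (Γ : SimpleGraph V) (K : Set V) : Prop :=
  Γ.IsClique K ∧ ∃ x y : ↥(Kᶜ), ¬ (Γ.induce Kᶜ).Reachable x y

open Classical in
/-- Vertices whose generators commute in the right-angled Artin group are equal or adjacent. -/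
theorem RAAG.eq_or_adj_of_commute {V : Type} (Γ : SimpleGraph V) {u v : V}
    (h : Commute (RAAG.gen Γ u) (RAAG.gen Γ v)) : u = v ∨ Γ.Adj u v := by
  by_contra! hne
  obtain ⟨huv, hadj⟩ := hne
  let f : V → Equiv.Perm (Fin 3) := fun x =>
    if x = u then Equiv.swap 0 1 else if x = v then Equiv.swap 1 2 else 1
  have hrel : ∀ r ∈ raagRels Γ, FreeGroup.lift f r = 1 := by
    rintro r ⟨x, y, hxy, rfl⟩
    have hcomm : f x * f y = f y * f x := by
      have hne := hxy.ne
      by_cases hxu : x = u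
      · have hyu : y ≠ u := fun hy => hne (hxu.trans hy.symm)
        have hyv : y ≠ v := fun hy => hadj (hxu ▸ hy ▸ hxy)
        simp [f, hyu, hyv]
      · by_cases hxv : x = v
        · have hyv : y ≠ v := fun hy => hne (hxv.trans hy.symm)
          have hyu : y ≠ u := fun hy => hadj (hxv ▸ hy ▸ hxy.symm)
          simp [f, hyu, hyv]
        · simp [f, hxu, hxv]
    simp [hcomm]
  have hu : PresentedGroup.toGroup hrel (RAAG.gen Γ u) = Equiv.swap 0 1 := by
    simp [RAAG.gen, f]
  have hv : PresentedGroup.toGroup hrel (RAAG.gen Γ v) = Equiv.swap 1 2 := by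
    simp [RAAG.gen, f, huv.symm]
  have hcomm := h.map (PresentedGroup.toGroup hrel)
  rw [hu, hv] at hcomm
  exact absurd hcomm.eq (by decide)

/-- The generators of adjacent vertices commute in the right-angled Artin group. -/
theorem RAAG.commute_of_adj {V : Type} {Γ : SimpleGraph V} {u v : V} (h : Γ.Adj u v) :
    Commute (RAAG.gen Γ u) (RAAG.gen Γ v) := by
  have hone := PresentedGroup.one_of_mem (rels := raagRels Γ) ⟨u, v, h, rfl⟩
  simp only [map_mul, map_inv] at hone
  exact mul_inv_eq_iff_eq_mul.mp (mul_inv_eq_one.mp hone)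

namespace SimpleGraph

variable {W : Type} {T : SimpleGraph W}

/-- A walk that leaves the side of `a` of the edge `s(a, b)` passes through `a` and `b`. -/
theorem Walk.mem_support_of_reachable_deleteEdges {a b x y : W} (p : T.Walk x y)
    (hx : (T.deleteEdges {s(a, b)}).Reachable x a)
    (hy : ¬ (T.deleteEdges {s(a, b)}).Reachable y a) : a ∈ p.support ∧ b ∈ p.support := by
  obtain ⟨d, hd, hfst, hsnd⟩ :=
    p.exists_boundary_dart {z | (T.deleteEdges {s(a, b)}).Reachable z a} hx hy
  have hedge : s(d.fst, d.snd) = s(a, b) := by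
    by_contra hne
    have hadj : (T.deleteEdges {s(a, b)}).Adj d.fst d.snd :=
      deleteEdges_adj.mpr ⟨d.adj, hne⟩
    exact hsnd (hadj.symm.reachable.trans hfst)
  have h₁ := p.dart_fst_mem_support_of_mem_darts hd
  have h₂ := p.dart_snd_mem_support_of_mem_darts hd
  rcases Sym2.eq_iff.mp hedge with ⟨rfl, rfl⟩ | ⟨rfl, rfl⟩
  · exact ⟨h₁, h₂⟩
  · exact ⟨h₂, h₁⟩

/-- Both endpoints of an edge separating `x` from `y` lie on a geodesic from `x` to `y`. -/
theorem Connected.dist_eq_of_reachable_deleteEdges (hT : T.Connected) {a b x y : W}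
    (hx : (T.deleteEdges {s(a, b)}).Reachable x a)
    (hy : ¬ (T.deleteEdges {s(a, b)}).Reachable y a) :
    T.dist x y = T.dist x a + T.dist a y ∧ T.dist x y = T.dist x b + T.dist b y := by
  classical
  obtain ⟨p, hp⟩ := hT.exists_walk_length_eq_dist x y
  have key : ∀ z ∈ p.support, T.dist x y = T.dist x z + T.dist z y := by
    intro z hz
    refine le_antisymm hT.dist_triangle ?_
    have h₁ := dist_le (p.takeUntil z hz)
    have h₂ := dist_le (p.dropUntil z hz)
    have h₃ := congrArg Walk.length (p.take_spec hz)
    rw [Walk.length_append] at h₃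
    lia
  have h := p.mem_support_of_reachable_deleteEdges hx hy
  exact ⟨key a h.1, key b h.2⟩

theorem IsTree.not_reachable_deleteEdges (hT : T.IsTree) {a b : W} (hab : T.Adj a b) :
    ¬ (T.deleteEdges {s(a, b)}).Reachable a b :=
  isBridge_iff.mp (isAcyclic_iff_forall_adj_isBridge.mp hT.isAcyclic hab)

/-- The first edge of the path from `w` to `q` separates `w` from `q`. -/
theorem Connected.exists_adj_reachable_deleteEdges (hT : T.Connected) {w q : W} (hne : w ≠ q) :
    ∃ w', T.Adj w w' ∧ (T.deleteEdges {s(w, w')}).Reachable q w' := by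
  obtain ⟨p, hp, -⟩ := hT.exists_path_of_dist w q
  cases p with
  | nil => exact absurd rfl hne
  | cons h p =>
    refine ⟨_, h, ?_⟩
    rw [Walk.cons_isPath_iff] at hp
    exact (p.toDeleteEdge _ fun hmem =>
      hp.2 (p.fst_mem_support_of_mem_edges hmem)).reachable.symm

/-- A set of vertices is path-closed if it contains every path between its points. -/
def PathClosed (T : SimpleGraph W) (S : Set W) : Prop :=
  ∀ ⦃x y : W⦄, x ∈ S → y ∈ S → ∀ p : T.Walk x y, p.IsPath → ∀ z ∈ p.support, z ∈ S

/-- A path-closed set not containing an edge lies on one side of it. -/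
theorem PathClosed.reachable_deleteEdges {S : Set W} (hS : PathClosed T S) (hT : T.Connected)
    {a b : W} (hab : ¬ (a ∈ S ∧ b ∈ S)) {x y : W} (hx : x ∈ S) (hy : y ∈ S)
    (h : (T.deleteEdges {s(a, b)}).Reachable x a) :
    (T.deleteEdges {s(a, b)}).Reachable y a := by
  by_contra hn
  obtain ⟨p, hp, -⟩ := hT.exists_path_of_dist x y
  obtain ⟨h₁, h₂⟩ := p.mem_support_of_reachable_deleteEdges h hn
  exact hab ⟨hS hx hy p hp _ h₁, hS hx hy p hp _ h₂⟩

/-- A nonempty set of vertices has a point nearest to a given vertex. -/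
theorem exists_dist_le_of_nonempty {S : Set W} (hS : S.Nonempty) (w : W) :
    ∃ q ∈ S, ∀ s ∈ S, T.dist w q ≤ T.dist w s := by
  obtain ⟨q, hq, hmin⟩ := (measure (T.dist w)).wf.has_min S hS
  exact ⟨q, hq, fun s hs => not_lt.mp (hmin s hs)⟩

/-- Helly-type criterion: if for every edge `s(a, b)` the members of a finite family of
nonempty sets not containing the edge lie on a common side of it, then the family has
a common point. -/
theorem IsTree.exists_mem_of_forall_adj {V : Type} [Finite V] (hT : T.IsTree) (F : V → Set W)
    (hne : ∀ v, (F v).Nonempty)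
    (hside : ∀ a b, T.Adj a b → ∀ u v, ¬ (a ∈ F u ∧ b ∈ F u) → ¬ (a ∈ F v ∧ b ∈ F v) →
      ∀ x ∈ F u, ∀ y ∈ F v, (T.deleteEdges {s(a, b)}).Reachable x a →
        (T.deleteEdges {s(a, b)}).Reachable y a) :
    ∃ w, ∀ v, w ∈ F v := by
  have := Fintype.ofFinite V
  have hconn := hT.connected
  choose q hq hqmin using fun (v : V) (w : W) => exists_dist_le_of_nonempty (T := T) (hne v) w
  have : Nonempty W := hconn.nonempty
  obtain ⟨w, -, hw⟩ :=
    (measure fun w => ∑ v, T.dist w (q v w)).wf.has_min Set.univ Set.univ_nonempty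
  refine ⟨w, ?_⟩
  by_contra! hcon
  obtain ⟨u, hu⟩ := hcon
  have hwq : w ≠ q u w := fun h => hu (h ▸ hq u w)
  obtain ⟨w', hadj, hreach⟩ := hconn.exists_adj_reachable_deleteEdges hwq
  have hbridge := hT.not_reachable_deleteEdges hadj
  have hstep : ∀ v, ¬ (w ∈ F v ∧ w' ∈ F v) → T.dist w' (q v w') < T.dist w (q v w) := by
    intro v hv
    have hside' := hside w' w hadj.symm u v (fun h => hu h.2) (fun h => hv h.symm) _ (hq u w)
      _ (hq v w)
    rw [Sym2.eq_swap] at hside'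
    have hvr := hside' hreach
    have hd := (hconn.dist_eq_of_reachable_deleteEdges (Reachable.refl w)
      (fun h => hbridge (h.symm.trans hvr))).2
    rw [dist_eq_one_iff_adj.mpr hadj] at hd
    have := hqmin v w' _ (hq v w)
    lia
  refine hw w' trivial (show ∑ v, T.dist w' (q v w') < ∑ v, T.dist w (q v w) from
    Finset.sum_lt_sum (fun v _ => ?_) ⟨u, Finset.mem_univ u, ?_⟩)
  · by_cases hv : w ∈ F v ∧ w' ∈ F v
    · have := hqmin v w' _ hv.2
      rw [dist_self] at this
      lia
    · exact (hstep v hv).le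
  · exact hstep u fun h => hu h.1

end SimpleGraph

section Action

variable {G W : Type} [Group G] {T : SimpleGraph W} {φ : G →* Equiv.Perm W}

/-- The fixed set of an element acting on a tree is path-closed. -/
theorem PreservesAdj.pathClosed_fixed (hadj : PreservesAdj T φ) (hT : T.IsTree) (g : G) :
    SimpleGraph.PathClosed T {w | φ g w = w} := by
  intro x y hx hy p hp z hz
  let f : T →g T := ⟨φ g, fun h => hadj g _ _ h⟩
  have hinj : Function.Injective f := (φ g).injective
  have hp' : ((p.map f).copy hx hy).IsPath := by
    simpa using hp.map hinj
  have heq : (p.map f).copy hx hy = p :=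
    (hT.existsUnique_path x y).unique hp' hp
  have hsupp : p.support.map f = p.support := by
    simpa using congrArg SimpleGraph.Walk.support heq
  exact List.map_inj_left.mp (hsupp.trans p.support.map_id.symm) z hz

/-- A group acting by automorphisms of a connected graph preserves distances. -/
theorem PreservesAdj.dist_eq (hadj : PreservesAdj T φ) (hT : T.Connected) (g : G) (x y : W) :
    T.dist (φ g x) (φ g y) = T.dist x y := by
  have key : ∀ (g : G) (x y : W), T.dist (φ g x) (φ g y) ≤ T.dist x y := by
    intro g x y
    obtain ⟨p, hp⟩ := hT.exists_walk_length_eq_dist x y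
    let f : T →g T := ⟨φ g, fun h => hadj g _ _ h⟩
    rw [← hp, ← p.length_map f]
    exact SimpleGraph.dist_le _
  refine le_antisymm (key g x y) ?_
  simpa [map_inv] using key g⁻¹ (φ g x) (φ g y)

/-- Commuting elliptic elements have a common fixed vertex. -/
theorem PreservesAdj.exists_fixed_of_commute (hadj : PreservesAdj T φ) (hT : T.IsTree) {g h : G}
    (hg : Elliptic φ g) (hh : Elliptic φ h) (hcomm : Commute g h) :
    ∃ w, φ g w = w ∧ φ h w = w := by
  obtain ⟨p, hp⟩ := hh
  obtain ⟨q, hq, hmin⟩ := SimpleGraph.exists_dist_le_of_nonempty (T := T)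
    (S := {w | φ g w = w}) hg p
  refine ⟨q, hq, ?_⟩
  by_cases hqp : q = p
  · rw [hqp, hp]
  obtain ⟨q', hadj', hreach⟩ := hT.connected.exists_adj_reachable_deleteEdges hqp
  have hp_far : ¬ (T.deleteEdges {s(q, q')}).Reachable p q := fun h =>
    hT.not_reachable_deleteEdges hadj' (h.symm.trans hreach)
  have hq' : ¬ (φ g q' = q') := by
    intro hfix
    have h₁ := hmin q' hfix
    have h₂ := (hT.connected.dist_eq_of_reachable_deleteEdges (.refl q) hp_far).2
    rw [SimpleGraph.dist_eq_one_iff_adj.mpr hadj', T.dist_comm, T.dist_comm (u := q')] at h₂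
    lia
  have hhq : φ g (φ h q) = φ h q := by
    rw [← Equiv.Perm.mul_apply, ← map_mul, hcomm.eq, map_mul, Equiv.Perm.mul_apply, hq]
  have hside := (hadj.pathClosed_fixed hT g).reachable_deleteEdges hT.connected
    (fun h => hq' h.2) hq hhq (.refl q)
  have hd := (hT.connected.dist_eq_of_reachable_deleteEdges hside hp_far).1
  have hiso := hadj.dist_eq hT.connected h q p
  rw [hp] at hiso
  exact hT.connected.dist_eq_zero_iff.mp (by lia)

end Action

/-- If `Γ` is a finite connected simplicial graph and `A(Γ)` acts without inversions
on a simplicial tree with abelian edge stabilizers, every vertex of `Γ` elliptic and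
no global fixed vertex, then `Γ` contains a separating clique `K` whose vertices
have a common fixed edge in the tree: the generators corresponding to the vertices
of `K` all fix both endpoints of some edge. -/
theorem separating_clique_fixing_edge {V W : Type} [Finite V]
    (Γ : SimpleGraph V) (hconn : Γ.Connected)
    (T : SimpleGraph W) (hT : T.IsTree) (φ : RAAG Γ →* Equiv.Perm W)
    (hadj : PreservesAdj T φ) (hni : NoInversions T φ)
    (hab : AbelianEdgeStabilizers T φ)
    (hvert : ∀ v : V, Elliptic φ (RAAG.gen Γ v))
    (hnofix : ¬ HasGlobalFixedVertex φ) :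
    ∃ K : Set V, SeparatingClique Γ K ∧
      ∃ u w : W, T.Adj u w ∧
        ∀ k ∈ K, φ (RAAG.gen Γ k) u = u ∧ φ (RAAG.gen Γ k) w = w := by
  by_contra hcon
  refine hnofix ?_
  let F : V → Set W := fun v => {w | φ (RAAG.gen Γ v) w = w}
  have hF : ∀ v, SimpleGraph.PathClosed T (F v) := fun v => hadj.pathClosed_fixed hT _
  obtain ⟨w, hw⟩ := hT.exists_mem_of_forall_adj F hvert (by
    intro a b hab' u v hu hv x hx y hy hxa
    let K : Set V := {k | a ∈ F k ∧ b ∈ F k}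
    have hK : Γ.IsClique K := fun k hk l hl hkl =>
      (RAAG.eq_or_adj_of_commute Γ (hab a b hab' _ _ hk.1 hk.2 hl.1 hl.2)).resolve_left hkl
    have hreach : (Γ.induce Kᶜ).Reachable ⟨u, hu⟩ ⟨v, hv⟩ := by
      by_contra hn
      exact hcon ⟨K, ⟨hK, _, _, hn⟩, a, b, hab', fun k hk => hk⟩
    have hwalk : ∀ {s t : ↥(Kᶜ)}, (Γ.induce Kᶜ).Walk s t → ∀ x ∈ F s, ∀ y ∈ F t,
        (T.deleteEdges {s(a, b)}).Reachable x a → (T.deleteEdges {s(a, b)}).Reachable y a := by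
      intro s t p
      induction p with
      | @nil s =>
        intro x hx y hy
        exact (hF s).reachable_deleteEdges hT.connected s.2 hx hy
      | @cons s r t hsr p ih =>
        intro x hx y hy hxa
        obtain ⟨z, hz₁, hz₂⟩ := hadj.exists_fixed_of_commute hT (hvert s) (hvert r)
          (RAAG.commute_of_adj hsr)
        exact ih z hz₂ y hy
          ((hF s).reachable_deleteEdges hT.connected s.2 hx hz₁ hxa)
    exact hreach.elim fun p => hwalk p x hx y hy hxa)
  refine ⟨w, fun g => ?_⟩
  let H : Subgroup (RAAG Γ) := (MulAction.stabilizer (Equiv.Perm W) w).comap φ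
  exact PresentedGroup.generated_by _ H (fun v => hw v) g
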